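/- Let K be a field of characteristic zero, G a finite group, and H ≤ G a subgroup such that the group algebra K[H] is not reduced (K[H] contains a nonzero nilpotent element). If N is a normal subgroup of G that is a nonideal-kernel witness over K (for G), then N ⊆ H, and N, viewed as a normal subgroup of H, is a nonideal-kernel witness over K for H. -/

import Mathlib

open scoped BigOperators

/-- The averaging element `e_N = (1/|N|) ∑_{n ∈ N} n` in the group algebra `K[G]`. -/
noncomputable def aveIdem (K : Type*) [Field K] {G : Type*} [Group G] (N : Subgroup G) :
    MonoidAlgebra K G :=
  (Nat.card N : K)⁻¹ • ∑ᶠ n : N, MonoidAlgebra.of K G (n : G)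

/-- `N` is a nonideal-kernel witness over `K`: every nilpotent element `x` of `K[G]`
satisfies `x * e_N = x`. -/
def IsNKW (K : Type*) [Field K] {G : Type*} [Group G] (N : Subgroup G) : Prop :=
  ∀ x : MonoidAlgebra K G, IsNilpotent x → x * aveIdem K N = x

theorem aveIdem_mul_of {K : Type*} [Field K] {G : Type*} [Group G] [Finite G]
    (N : Subgroup G) {n : G} (hn : n ∈ N) :
    aveIdem K N * MonoidAlgebra.of K G n = aveIdem K N := by
  have := Fintype.ofFinite N
  simp only [aveIdem, finsum_eq_sum_of_fintype, smul_mul_assoc, Finset.sum_mul, ← map_mul]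
  congr 1
  exact Fintype.sum_equiv (Equiv.mulRight (⟨n, hn⟩ : N)) _ _ fun m => rfl

theorem mapDomain_aveIdem {K : Type*} [Field K] {G : Type*} [Group G] [Finite G]
    {H N : Subgroup G} (hNH : N ≤ H) :
    MonoidAlgebra.mapDomainAlgHom K K H.subtype (aveIdem K (N.subgroupOf H)) = aveIdem K N := by
  have := Fintype.ofFinite N
  have := Fintype.ofFinite (N.subgroupOf H)
  let e := Subgroup.subgroupOfEquivOfLe hNH
  simp only [aveIdem, finsum_eq_sum_of_fintype, map_smul, map_sum, Nat.card_congr e.toEquiv]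
  congr 1
  refine Fintype.sum_equiv e.toEquiv _ _ fun m => ?_
  simp [e]

theorem stmt6 (K : Type*) [Field K] [CharZero K] (G : Type*) [Group G] [Finite G]
    (H : Subgroup G) (hH : ¬ IsReduced (MonoidAlgebra K H))
    (N : Subgroup G) (hN : N.Normal) (hNKW : IsNKW K N) :
    N ≤ H ∧ IsNKW K (N.subgroupOf H) := by
  let φ := MonoidAlgebra.mapDomainAlgHom K K H.subtype
  have hφ : Function.Injective φ := MonoidAlgebra.mapDomain_injective H.subtype_injective
  have hNH : N ≤ H := by
    intro n hn
    rw [isReduced_iff] at hH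
    push Not at hH
    obtain ⟨x, hx, hx0⟩ := hH
    have hxn : φ x * MonoidAlgebra.of K G n = φ x := by
      rw [← hNKW (φ x) (hx.map φ), mul_assoc, aveIdem_mul_of N hn]
    obtain ⟨h, hh⟩ : ∃ h : H, x.coeff h ≠ 0 := by
      by_contra! hc
      exact hx0 (by ext h; exact hc h)
    by_contra hnH
    have hnot : (h : G) * n ∉ Set.range H.subtype := by
      rintro ⟨k, hk⟩
      refine hnH ((H.mul_mem_cancel_left h.2).1 ?_)
      rw [← hk]
      exact k.2
    have hzero : (φ x).coeff (h * n) = 0 := Finsupp.mapDomain_of_notMem_range _ _ hnot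
    have hcoeff : (φ x).coeff h = x.coeff h :=
      Finsupp.mapDomain_apply H.subtype_injective x.coeff h
    apply hh
    rw [← hcoeff, ← hzero]
    conv_rhs => rw [← hxn]
    simp
  refine ⟨hNH, fun x hx => hφ ?_⟩
  rw [map_mul, mapDomain_aveIdem hNH]
  exact hNKW _ (hx.map φ)
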